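/- Let n ≥ 2, let D be a bounded domain in ℝⁿ, let Q : D → (0,∞) be measurable, extended by 0 to ℝⁿ \ D, and let Φ : [0,∞] → [0,∞] be convex and non-decreasing. Fix x₀ ∈ ∂D and d₀ ∈ (0, sup_{z∈D} |z−x₀|), and set N = Φ(0) + (1/(Ω_n·d₀ⁿ)) · ∫_D Φ(Q^{n−1}(y)) dm(y). Then ∫₀^{d₀} dρ/‖Q‖_{n−1}(x₀,ρ) ≥ (1/(n·ω_{n−1}^{1/(n−1)})) · ∫_{eN}^{∞} dτ/(τ·[Φ⁻¹(τ)]^{1/(n−1)}). -/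

import Mathlib

open MeasureTheory Metric Set
open scoped ENNReal NNReal

/-- The generalized inverse `Φ⁻¹(τ) = inf{ t : Φ(t) ≥ τ }` of a non-decreasing
function `Φ : [0,∞] → [0,∞]` (with `inf ∅ = ∞`). -/
noncomputable def genInv (Φ : ℝ≥0∞ → ℝ≥0∞) (τ : ℝ≥0∞) : ℝ≥0∞ :=
  sInf {t : ℝ≥0∞ | τ ≤ Φ t}

/-- `‖Q‖_{n-1}(x₀,ρ) = (∫_{S(x₀,ρ)} Q^{n-1} dA)^{1/(n-1)}`, the `L^{n-1}`-norm of `Q`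
over the sphere `S(x₀,ρ)` with respect to the `(n-1)`-dimensional surface
(Hausdorff) measure. -/
noncomputable def sphNorm (n : ℕ) (Q : EuclideanSpace ℝ (Fin n) → ℝ≥0∞)
    (x₀ : EuclideanSpace ℝ (Fin n)) (ρ : ℝ) : ℝ≥0∞ :=
  (∫⁻ x in Metric.sphere x₀ ρ, (Q x) ^ ((n : ℝ) - 1) ∂(μH[(n : ℝ) - 1])) ^ (1 / ((n : ℝ) - 1))

/-- The convexity condition for functions `[0,∞] → [0,∞]`. -/
def ENNRealConvex (Φ : ℝ≥0∞ → ℝ≥0∞) : Prop :=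
  ∀ (a : ℝ≥0), a ≤ 1 → ∀ t₁ t₂ : ℝ≥0∞,
    Φ (a • t₁ + (1 - a) • t₂) ≤ a • Φ t₁ + (1 - a) • Φ t₂

theorem ENNRealConvex.convexOn_toReal {Φ : ℝ≥0∞ → ℝ≥0∞} (hconv : ENNRealConvex Φ) :
    ConvexOn ℝ {u : ℝ | 0 ≤ u ∧ Φ (ENNReal.ofReal u) < ∞}
      (fun u => (Φ (ENNReal.ofReal u)).toReal) := by
  have key : ∀ u v a b : ℝ, 0 ≤ u → 0 ≤ v → 0 ≤ a → 0 ≤ b → a + b = 1 →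
      Φ (ENNReal.ofReal (a * u + b * v)) ≤
        ENNReal.ofReal a * Φ (ENNReal.ofReal u) + ENNReal.ofReal b * Φ (ENNReal.ofReal v) := by
    intro u v a b hu hv ha hb hab
    have h := hconv a.toNNReal (by rw [Real.toNNReal_le_one]; linarith)
      (ENNReal.ofReal u) (ENNReal.ofReal v)
    have hb' : 1 - a.toNNReal = b.toNNReal := by
      rw [← Real.toNNReal_one, ← NNReal.coe_inj]
      rw [NNReal.coe_sub (Real.toNNReal_le_toNNReal (by linarith))]
      simp [ha, hb]; linarith
    rw [hb'] at h
    simp only [ENNReal.smul_def, smul_eq_mul] at h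
    change Φ (ENNReal.ofReal a * ENNReal.ofReal u + ENNReal.ofReal b * ENNReal.ofReal v) ≤
      ENNReal.ofReal a * Φ (ENNReal.ofReal u) + ENNReal.ofReal b * Φ (ENNReal.ofReal v) at h
    rwa [← ENNReal.ofReal_mul ha, ← ENNReal.ofReal_mul hb,
      ← ENNReal.ofReal_add (by positivity) (by positivity)] at h
  refine ⟨?_, ?_⟩
  · rintro u ⟨hu, hu'⟩ v ⟨hv, hv'⟩ a b ha hb hab
    simp only [smul_eq_mul]
    refine ⟨by positivity, (key u v a b hu hv ha hb hab).trans_lt ?_⟩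
    exact ENNReal.add_lt_top.2 ⟨ENNReal.mul_lt_top ENNReal.ofReal_lt_top hu',
      ENNReal.mul_lt_top ENNReal.ofReal_lt_top hv'⟩
  · rintro u ⟨hu, hu'⟩ v ⟨hv, hv'⟩ a b ha hb hab
    simp only [smul_eq_mul]
    have h1 := ENNReal.mul_lt_top (ENNReal.ofReal_lt_top (r := a)) hu'
    have h2 := ENNReal.mul_lt_top (ENNReal.ofReal_lt_top (r := b)) hv'
    have := ENNReal.toReal_mono (ENNReal.add_lt_top.2 ⟨h1, h2⟩).ne (key u v a b hu hv ha hb hab)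
    rwa [ENNReal.toReal_add h1.ne h2.ne, ENNReal.toReal_mul, ENNReal.toReal_mul,
      ENNReal.toReal_ofReal ha, ENNReal.toReal_ofReal hb] at this

/-- A supporting line of a convex non-decreasing function at a point which is not the right
endpoint of its effective domain. -/
theorem ENNRealConvex.exists_supporting_line {Φ : ℝ≥0∞ → ℝ≥0∞} (hmono : Monotone Φ)
    (hconv : ENNRealConvex Φ) {t y : ℝ≥0∞} (hty : t < y) (hy : Φ y < ∞) :
    ∃ k : ℝ≥0, ∀ x < ∞, Φ t + k * x ≤ Φ x + k * t := by
  have hf := hconv.convexOn_toReal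
  set s := {u : ℝ | 0 ≤ u ∧ Φ (ENNReal.ofReal u) < ∞}
  set f := fun u : ℝ => (Φ (ENNReal.ofReal u)).toReal with hfdef
  have ht : t < ∞ := hty.trans_le le_top
  lift t to ℝ≥0 using ht.ne
  have hts : (t : ℝ) ∈ s := ⟨t.2, by
    rw [ENNReal.ofReal_coe_nnreal]; exact (hmono hty.le).trans_lt hy⟩
  obtain ⟨z, htz, hzy⟩ := ENNReal.lt_iff_exists_nnreal_btwn.1 hty
  have hzs : (z : ℝ) ∈ s := ⟨z.2, by
    rw [ENNReal.ofReal_coe_nnreal]; exact (hmono hzy.le).trans_lt hy⟩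
  have htz' : (t : ℝ) < z := by exact_mod_cast htz
  set K := {m : ℝ | ∃ u ∈ s, (t : ℝ) < u ∧ m = (f u - f t) / (u - t)}
  have hKne : K.Nonempty := ⟨_, z, hzs, htz', rfl⟩
  have hK0 : ∀ m ∈ K, 0 ≤ m := by
    rintro m ⟨u, hu, htu, rfl⟩
    refine div_nonneg (sub_nonneg.2 ?_) (sub_pos.2 htu).le
    exact ENNReal.toReal_mono hu.2.ne (hmono (ENNReal.ofReal_le_ofReal htu.le))
  have hk0 : 0 ≤ sInf K := Real.sInf_nonneg hK0
  refine ⟨⟨sInf K, hk0⟩, fun x hx => ?_⟩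
  lift x to ℝ≥0 using hx.ne
  by_cases hxs : Φ x < ∞
  swap
  · rw [not_lt_top_iff.1 hxs]; simp
  have hxs' : (x : ℝ) ∈ s := ⟨x.2, by rwa [ENNReal.ofReal_coe_nnreal]⟩
  have key : f t + sInf K * x ≤ f x + sInf K * t := by
    rcases lt_trichotomy (x : ℝ) t with h | h | h
    · have : (f t - f x) / (t - x) ≤ sInf K := by
        refine le_csInf hKne ?_
        rintro m ⟨u, hu, htu, rfl⟩
        exact hf.slope_mono_adjacent hxs' hu h htu
      rw [div_le_iff₀ (by linarith)] at this
      linarith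
    · rw [h]
    · have : sInf K ≤ (f x - f t) / (x - t) := csInf_le ⟨0, hK0⟩ ⟨x, hxs', h, rfl⟩
      rw [le_div_iff₀ (by linarith)] at this
      linarith
  have e : ∀ u : ℝ≥0, Φ u < ∞ → Φ u = ENNReal.ofReal (f u) := by
    intro u hu
    simp only [hfdef, ENNReal.ofReal_coe_nnreal]
    rw [ENNReal.ofReal_toReal hu.ne]
  have e' : ∀ u : ℝ≥0, ENNReal.ofNNReal ⟨sInf K, hk0⟩ * u = ENNReal.ofReal (sInf K * u) := by
    intro u
    rw [ENNReal.ofReal_mul hk0, ENNReal.ofReal_coe_nnreal]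
    congr 1
    exact (ENNReal.ofReal_eq_coe_nnreal hk0).symm
  rw [e' x, e' t, e x hxs, e t ((hmono hty.le).trans_lt hy),
    ← ENNReal.ofReal_add ENNReal.toReal_nonneg (by positivity),
    ← ENNReal.ofReal_add ENNReal.toReal_nonneg (by positivity)]
  exact ENNReal.ofReal_le_ofReal key

/-- Jensen's inequality for convex non-decreasing functions `[0,∞] → [0,∞]`, in a form which does
not require left-continuity at the endpoints of the effective domain. -/
theorem ENNRealConvex.le_lintegral_of_lt_lintegral {α : Type*} [MeasurableSpace α]
    {P : Measure α} [IsProbabilityMeasure P] {Φ : ℝ≥0∞ → ℝ≥0∞} (hmono : Monotone Φ)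
    (hconv : ENNRealConvex Φ) {X : α → ℝ≥0∞} (hX : Measurable X) (hXfin : ∀ a, X a < ∞)
    {t : ℝ≥0∞} (ht : t < ∫⁻ a, X a ∂P) : Φ t ≤ ∫⁻ a, Φ (X a) ∂P := by
  have hΦX : Measurable fun a => Φ (X a) := hmono.measurable.comp hX
  by_cases hex : ∃ y, t < y ∧ Φ y < ∞
  · obtain ⟨y, hty, hy⟩ := hex
    obtain ⟨k, hk⟩ := ENNRealConvex.exists_supporting_line hmono hconv hty hy
    have h1 : ∫⁻ a, (Φ t + k * X a) ∂P ≤ ∫⁻ a, (Φ (X a) + k * t) ∂P :=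
      lintegral_mono fun a => hk _ (hXfin a)
    rw [lintegral_add_left measurable_const, lintegral_add_right _ measurable_const,
      lintegral_const_mul _ hX] at h1
    simp only [lintegral_const, measure_univ, mul_one] at h1
    have hkt : (k : ℝ≥0∞) * t ≠ ∞ :=
      ENNReal.mul_ne_top ENNReal.coe_ne_top (hty.trans_le le_top).ne
    refine (ENNReal.add_le_add_iff_right hkt).1 (le_trans ?_ h1)
    gcongr
  · push Not at hex
    by_contra hlt
    have hfin : ∫⁻ a, Φ (X a) ∂P ≠ ∞ := ((not_le.1 hlt).trans_le le_top).ne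
    have hae : ∀ᵐ a ∂P, X a ≤ t := by
      filter_upwards [ae_lt_top hΦX hfin] with a ha
      by_contra h
      exact absurd (hex _ (not_le.1 h)) (not_le.2 ha)
    refine absurd ht (not_lt.2 ?_)
    calc ∫⁻ a, X a ∂P ≤ ∫⁻ _, t ∂P := lintegral_mono_ae hae
      _ = t := by simp

theorem ENNRealConvex.lintegral_le_genInv {α : Type*} [MeasurableSpace α]
    {P : Measure α} [IsProbabilityMeasure P] {Φ : ℝ≥0∞ → ℝ≥0∞} (hmono : Monotone Φ)
    (hconv : ENNRealConvex Φ) {X : α → ℝ≥0∞} (hX : Measurable X) (hXfin : ∀ a, X a < ∞)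
    {τ : ℝ≥0∞} (hτ : ∫⁻ a, Φ (X a) ∂P < τ) : ∫⁻ a, X a ∂P ≤ genInv Φ τ := by
  refine le_sInf fun t ht => ?_
  by_contra h
  exact absurd (ENNRealConvex.le_lintegral_of_lt_lintegral hmono hconv hX hXfin (not_le.1 h))
    (not_le.2 (hτ.trans_le ht))

theorem genInv_mono (Φ : ℝ≥0∞ → ℝ≥0∞) : Monotone (genInv Φ) :=
  fun _ _ h => sInf_le_sInf fun _ ht => h.trans ht

/-- Removing a set of measure at most `1` from `(0,∞)` decreases the integral of a non-increasing
function at most as much as removing `(0,1]`. -/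
theorem Antitone.setLIntegral_Ioi_one_le {g : ℝ → ℝ≥0∞} (hg : Antitone g) {T : Set ℝ}
    (hT : MeasurableSet T) (hT1 : volume (T ∩ Ioi 0) ≤ 1) :
    ∫⁻ s in Ioi 1, g s ≤ ∫⁻ s in Ioi 0 \ T, g s := by
  have hvol : volume (Ioi 1 ∩ T) ≤ volume (Ioc (0 : ℝ) 1 \ T) := by
    have h1 : volume (Ioc (0 : ℝ) 1 ∩ T) + volume (Ioc (0 : ℝ) 1 \ T) = 1 := by
      rw [measure_inter_add_sdiff _ hT]; simp
    have h2 : volume (Ioc (0 : ℝ) 1 ∩ T) + volume (Ioi 1 ∩ T) ≤ 1 := by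
      rw [← measure_union _ (measurableSet_Ioi.inter hT)]
      · refine (measure_mono ?_).trans hT1
        rintro x (⟨hx, hxT⟩ | ⟨hx, hxT⟩)
        · exact ⟨hxT, hx.1⟩
        · exact ⟨hxT, zero_lt_one.trans (mem_Ioi.1 hx)⟩
      · exact Set.disjoint_left.2 fun x hx hx' => absurd hx.1.2 (not_le.2 hx'.1)
    have hfin : volume (Ioc (0 : ℝ) 1 ∩ T) ≠ ∞ :=
      ne_top_of_le_ne_top ENNReal.one_ne_top (le_self_add.trans h2)
    rw [← h1] at h2
    exact (ENNReal.add_le_add_iff_left hfin).1 h2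
  calc ∫⁻ s in Ioi 1, g s
      = (∫⁻ s in Ioi 1 ∩ T, g s) + ∫⁻ s in Ioi 1 \ T, g s :=
        (lintegral_inter_add_sdiff _ _ hT).symm
    _ ≤ (∫⁻ s in Ioc 0 1 \ T, g s) + ∫⁻ s in Ioi 1 \ T, g s := by
        gcongr ?_ + _
        calc ∫⁻ s in Ioi 1 ∩ T, g s ≤ ∫⁻ _ in Ioi 1 ∩ T, g 1 :=
              setLIntegral_mono' (measurableSet_Ioi.inter hT) fun s hs => hg (le_of_lt hs.1)
          _ = g 1 * volume (Ioi 1 ∩ T) := setLIntegral_const _ _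
          _ ≤ g 1 * volume (Ioc (0 : ℝ) 1 \ T) := by gcongr
          _ = ∫⁻ _ in Ioc 0 1 \ T, g 1 := (setLIntegral_const _ _).symm
          _ ≤ ∫⁻ s in Ioc 0 1 \ T, g s :=
              setLIntegral_mono' (measurableSet_Ioc.diff hT) fun s hs => hg hs.1.2
    _ = ∫⁻ s in Ioi 0 \ T, g s := by
        rw [← lintegral_union (measurableSet_Ioi.diff hT)]
        · congr 2
          rw [← Set.union_sdiff_distrib, Ioc_union_Ioi_eq_Ioi zero_le_one]
        · exact Set.disjoint_left.2 fun x hx hx' => absurd hx.1.2 (not_le.2 hx'.1)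

theorem setLIntegral_inv_genInv_exp_le {Φ : ℝ≥0∞ → ℝ≥0∞} {h q : ℝ → ℝ≥0∞} (hh : Measurable h)
    {N : ℝ} (hN0 : 0 < N)
    (hN : ∫⁻ s in Ioi 0, ENNReal.ofReal (Real.exp (-s)) * h s ≤ ENNReal.ofReal N)
    (hq : ∀ s τ, h s < τ → q s ≤ genInv Φ τ) {p : ℝ} (hp : 0 ≤ p) :
    ∫⁻ s in Ioi 1, (genInv Φ (ENNReal.ofReal (N * Real.exp s)) ^ p)⁻¹ ≤
      ∫⁻ s in Ioi 0, (q s ^ p)⁻¹ := by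
  set F : ℝ → ℝ≥0∞ := fun s => ENNReal.ofReal (Real.exp (-s)) * h s with hF
  have hFm : Measurable F := by fun_prop
  set T : Set ℝ := {s | ENNReal.ofReal N ≤ F s}
  have hT : MeasurableSet T := measurableSet_le measurable_const hFm
  have hT1 : volume (T ∩ Ioi 0) ≤ 1 := by
    have := (mul_meas_ge_le_lintegral (μ := volume.restrict (Ioi 0)) hFm (ENNReal.ofReal N)).trans hN
    rw [Measure.restrict_apply hT] at this
    have h0 : ENNReal.ofReal N ≠ 0 := by simpa using hN0
    exact (ENNReal.mul_le_mul_iff_right h0 ENNReal.ofReal_ne_top).1 (by rwa [mul_one])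
  have hanti : Antitone fun s => (genInv Φ (ENNReal.ofReal (N * Real.exp s)) ^ p)⁻¹ := by
    intro a b hab
    refine ENNReal.inv_le_inv.2 (ENNReal.rpow_le_rpow (genInv_mono Φ ?_) hp)
    exact ENNReal.ofReal_le_ofReal (by gcongr)
  refine (hanti.setLIntegral_Ioi_one_le hT hT1).trans
    (le_trans ?_ (lintegral_mono_set (s := Ioi 0 \ T) sdiff_subset))
  refine setLIntegral_mono' (measurableSet_Ioi.diff hT) fun s hs => ?_
  refine ENNReal.inv_le_inv.2 (ENNReal.rpow_le_rpow (hq _ _ ?_) hp)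
  have hs2 : F s < ENNReal.ofReal N := not_le.1 hs.2
  calc h s = ENNReal.ofReal (Real.exp s) * F s := by
        rw [hF, ← mul_assoc, ← ENNReal.ofReal_mul (Real.exp_pos _).le, ← Real.exp_add]
        simp
    _ < ENNReal.ofReal (Real.exp s) * ENNReal.ofReal N := by
        refine (ENNReal.mul_lt_mul_iff_right ?_ ENNReal.ofReal_ne_top).2 hs2
        simpa using Real.exp_pos s
    _ = ENNReal.ofReal (N * Real.exp s) := by
        rw [← ENNReal.ofReal_mul (Real.exp_pos _).le, mul_comm]

/-- Two finite measures concentrated on a set `S`, both of which give the same mass to all balls of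
equal radius centred on `S`, are proportional. -/
theorem MeasureTheory.Measure.measure_univ_smul_eq_of_uniformlyDistributed {E : Type*}
    [NormedAddCommGroup E] [NormedSpace ℝ E] [FiniteDimensional ℝ E] [MeasurableSpace E]
    [BorelSpace E] {S : Set E} (μ ν : Measure E) [IsFiniteMeasure μ] [IsFiniteMeasure ν]
    (hμS : ∀ᵐ x ∂μ, x ∈ S) (hνS : ∀ᵐ x ∂ν, x ∈ S)
    (hμ : ∀ x ∈ S, ∀ y ∈ S, ∀ r, μ (closedBall x r) = μ (closedBall y r))
    (hν : ∀ x ∈ S, ∀ y ∈ S, ∀ r, ν (closedBall x r) = ν (closedBall y r)) :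
    μ univ • ν = ν univ • μ := by
  have hac : μ ≪ μ + ν := Measure.AbsolutelyContinuous.rfl.add_right ν
  have hS : ∀ᵐ x ∂(μ + ν), x ∈ S := ae_add_measure_iff.2 ⟨hμS, hνS⟩
  have hlim := (Besicovitch.ae_tendsto_rnDeriv μ (μ + ν)).and hS
  have hconst : ∃ c, ∀ᵐ x ∂(μ + ν), μ.rnDeriv (μ + ν) x = c := by
    by_cases h0 : μ + ν = 0
    · exact ⟨0, by rw [h0]; simp⟩
    have : NeZero (μ + ν) := ⟨h0⟩
    obtain ⟨x₁, hx₁, hx₁S⟩ := hlim.exists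
    refine ⟨_, hlim.mono fun x hx => tendsto_nhds_unique hx.1 (hx₁.congr fun r => ?_)⟩
    simp only [Measure.add_apply]
    rw [hμ x₁ hx₁S x hx.2, hν x₁ hx₁S x hx.2]
  obtain ⟨c, hc⟩ := hconst
  have hμc : μ = c • (μ + ν) := by
    conv_lhs => rw [← Measure.withDensity_rnDeriv_eq μ (μ + ν) hac]
    rw [withDensity_congr_ae hc, withDensity_const]
  have hA : ∀ A, μ A = c * (μ A + ν A) := fun A => by
    conv_lhs => rw [hμc]
    rw [Measure.smul_apply, Measure.add_apply, smul_eq_mul]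
  ext A -
  simp only [Measure.smul_apply, smul_eq_mul]
  have h : μ univ * μ A + μ univ * ν A = μ univ * μ A + ν univ * μ A := by
    calc μ univ * μ A + μ univ * ν A = μ univ * (μ A + ν A) := by ring
      _ = c * (μ univ + ν univ) * (μ A + ν A) := by rw [← hA]
      _ = (μ univ + ν univ) * (c * (μ A + ν A)) := by ring
      _ = (μ univ + ν univ) * μ A := by rw [← hA]
      _ = _ := by ring
  exact (ENNReal.add_right_inj
    (ENNReal.mul_ne_top (measure_ne_top _ _) (measure_ne_top _ _))).1 h

section Sphere

variable {E : Type*} [NormedAddCommGroup E] [InnerProductSpace ℝ E]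

theorem LinearIsometryEquiv.exists_apply_eq_of_norm_eq {x y : E} (h : ‖x‖ = ‖y‖) :
    ∃ e : E ≃ₗᵢ[ℝ] E, e x = y :=
  ⟨_, Submodule.reflection_sub h⟩

theorem LinearIsometryEquiv.image_closedBall_inter_sphere (e : E ≃ₗᵢ[ℝ] E) (x : E) (r : ℝ) :
    e '' (closedBall x r ∩ sphere 0 1) = closedBall (e x) r ∩ sphere 0 1 := by
  rw [Set.image_inter e.injective, e.image_closedBall, e.image_sphere, map_zero]

variable [MeasurableSpace E] [BorelSpace E]

theorem hausdorffMeasure_closedBall_inter_sphere (d : ℝ) {x y : E} (h : ‖x‖ = ‖y‖) (r : ℝ) :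
    μH[d] (closedBall x r ∩ sphere 0 1) = μH[d] (closedBall y r ∩ sphere 0 1) := by
  obtain ⟨e, rfl⟩ := LinearIsometryEquiv.exists_apply_eq_of_norm_eq h
  rw [← e.image_closedBall_inter_sphere]
  exact (e.toIsometryEquiv.hausdorffMeasure_image d _).symm

open scoped Pointwise in
theorem setLIntegral_sphere_hausdorffMeasure {d : ℝ} (hd : 0 ≤ d) (x₀ : E) {ρ : ℝ} (hρ : 0 < ρ)
    {g : E → ℝ≥0∞} (hg : Measurable g) :
    ∫⁻ x in sphere x₀ ρ, g x ∂μH[d] =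
      ENNReal.ofReal ρ ^ d * ∫⁻ y in sphere (0 : E) 1, g (x₀ + ρ • y) ∂μH[d] := by
  set T : E → E := fun y => x₀ + ρ • y with hT
  have hTm : Measurable T := by fun_prop
  have hTim : ∀ A : Set E, μH[d] (T '' A) = ENNReal.ofReal ρ ^ d * μH[d] A := by
    intro A
    have h1 : T '' A = (IsometryEquiv.addLeft x₀) '' (ρ • A) := by
      rw [← image_smul, image_image]; rfl
    rw [h1, IsometryEquiv.hausdorffMeasure_image, Measure.hausdorffMeasure_smul₀ hd hρ.ne']
    rw [ENNReal.smul_def, smul_eq_mul, ENNReal.coe_rpow_of_nonneg _ hd]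
    congr 2
    rw [← enorm_eq_nnnorm, Real.enorm_of_nonneg hρ.le]
  have hS : ∀ A : Set E, T '' (T ⁻¹' A ∩ sphere 0 1) = A ∩ sphere x₀ ρ := by
    intro A
    rw [image_preimage_inter]
    congr 1
    ext x
    constructor
    · rintro ⟨y, hy, rfl⟩
      simp only [mem_sphere_iff_norm, sub_zero] at hy
      simp [hT, norm_smul, hy, abs_of_pos hρ]
    · intro hx
      refine ⟨ρ⁻¹ • (x - x₀), ?_, ?_⟩
      · rw [mem_sphere_iff_norm] at hx
        rw [mem_sphere_iff_norm, sub_zero, norm_smul, hx, Real.norm_of_nonneg (by positivity)]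
        field_simp
      · simp [hT, smul_smul, hρ.ne']
  have hmap : μH[d].restrict (sphere x₀ ρ) =
      (ENNReal.ofReal ρ ^ d) • (μH[d].restrict (sphere (0 : E) 1)).map T := by
    ext A hA
    rw [Measure.restrict_apply hA, Measure.smul_apply, Measure.map_apply hTm hA,
      Measure.restrict_apply (hTm hA), smul_eq_mul, ← hTim, hS]
  rw [hmap, lintegral_smul_measure, lintegral_map hg hTm, smul_eq_mul]

/-- The surface measure of the unit sphere, as a measure on the ambient space. -/
noncomputable def surfaceMeasure (E : Type*) [NormedAddCommGroup E] [InnerProductSpace ℝ E]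
    [MeasurableSpace E] [BorelSpace E] [FiniteDimensional ℝ E] : Measure E :=
  (volume : Measure E).toSphere.map Subtype.val

variable [FiniteDimensional ℝ E]

instance : IsFiniteMeasure (surfaceMeasure E) := by
  unfold surfaceMeasure; infer_instance

open scoped Pointwise in
theorem surfaceMeasure_apply {A : Set E} (hA : MeasurableSet A) :
    surfaceMeasure E A =
      Module.finrank ℝ E * volume (Ioo (0 : ℝ) 1 • (A ∩ sphere (0 : E) 1)) := by
  rw [surfaceMeasure, Measure.map_apply measurable_subtype_coe hA,
    Measure.toSphere_apply' _ (measurable_subtype_coe hA), Subtype.image_preimage_coe, inter_comm]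

theorem surfaceMeasure_univ :
    surfaceMeasure E univ = Module.finrank ℝ E * volume (ball (0 : E) 1) := by
  rw [surfaceMeasure, Measure.map_apply measurable_subtype_coe .univ, preimage_univ,
    Measure.toSphere_apply_univ]

theorem ae_surfaceMeasure_mem_sphere : ∀ᵐ x ∂(surfaceMeasure E), x ∈ sphere (0 : E) 1 := by
  refine (ae_map_iff (p := fun x : E => x ∈ sphere (0 : E) 1)
    measurable_subtype_coe.aemeasurable isClosed_sphere.measurableSet).2 ?_
  exact Filter.Eventually.of_forall fun x => x.2

open scoped Pointwise in
theorem surfaceMeasure_closedBall {x y : E} (h : ‖x‖ = ‖y‖) (r : ℝ) :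
    surfaceMeasure E (closedBall x r) = surfaceMeasure E (closedBall y r) := by
  obtain ⟨e, rfl⟩ := LinearIsometryEquiv.exists_apply_eq_of_norm_eq h
  rw [surfaceMeasure_apply measurableSet_closedBall, surfaceMeasure_apply measurableSet_closedBall,
    ← e.image_closedBall_inter_sphere]
  congr 1
  have : Ioo (0 : ℝ) 1 • (e '' (closedBall x r ∩ sphere 0 1)) =
      e '' (Ioo (0 : ℝ) 1 • (closedBall x r ∩ sphere 0 1)) := by
    rw [← image2_smul, ← image2_smul, image2_image_right, image_image2]
    simp
  rw [this, e.image_eq_preimage_symm]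
  exact (e.symm.measurePreserving.measure_preimage_emb
    e.symm.toMeasurableEquiv.measurableEmbedding _).symm

/-- If the Hausdorff measure of the unit sphere is finite, then it is proportional to the surface
measure. -/
theorem hausdorffMeasure_smul_surfaceMeasure (d : ℝ) (hfin : μH[d] (sphere (0 : E) 1) < ∞) :
    μH[d] (sphere (0 : E) 1) • surfaceMeasure E =
      surfaceMeasure E univ • μH[d].restrict (sphere (0 : E) 1) := by
  have : IsFiniteMeasure (μH[d].restrict (sphere (0 : E) 1)) := ⟨by simpa using hfin⟩
  have hn : ∀ x ∈ sphere (0 : E) 1, ∀ y ∈ sphere (0 : E) 1, ‖x‖ = ‖y‖ := fun x hx y hy => by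
    rw [mem_sphere_zero_iff_norm.1 hx, mem_sphere_zero_iff_norm.1 hy]
  have := Measure.measure_univ_smul_eq_of_uniformlyDistributed (S := sphere (0 : E) 1)
    (μH[d].restrict (sphere (0 : E) 1)) (surfaceMeasure E)
    (ae_restrict_mem isClosed_sphere.measurableSet) ae_surfaceMeasure_mem_sphere
    (fun x hx y hy r => by
      rw [Measure.restrict_apply measurableSet_closedBall,
        Measure.restrict_apply measurableSet_closedBall]
      exact hausdorffMeasure_closedBall_inter_sphere d (hn x hx y hy) r)
    (fun x hx y hy r => surfaceMeasure_closedBall (hn x hx y hy) r)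
  rwa [Measure.restrict_apply_univ] at this

/-- Integration in polar coordinates. -/
theorem lintegral_eq_lintegral_Ioi_surfaceMeasure [Nontrivial E] {G : E → ℝ≥0∞}
    (hG : Measurable G) :
    ∫⁻ x, G x = ∫⁻ r in Ioi (0 : ℝ), ENNReal.ofReal (r ^ (Module.finrank ℝ E - 1)) *
      ∫⁻ y, G (r • y) ∂(surfaceMeasure E) := by
  have hmeas : Measurable fun z : E × ℝ => G (z.2 • z.1) := by fun_prop
  have hmp := (volume : Measure E).measurePreserving_homeomorphUnitSphereProd
  calc ∫⁻ x, G x = ∫⁻ x in ({0}ᶜ : Set E), G x := by rw [restrict_compl_singleton]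
    _ = ∫⁻ x : ({0}ᶜ : Set E), G x ∂(volume.comap Subtype.val) :=
        (lintegral_subtype_comap (measurableSet_singleton _).compl _).symm
    _ = ∫⁻ z : sphere (0 : E) 1 × Ioi (0 : ℝ), G (z.2.1 • z.1.1)
          ∂((volume : Measure E).toSphere.prod
            (Measure.volumeIoiPow (Module.finrank ℝ E - 1))) := by
        rw [← hmp.lintegral_comp (by fun_prop)]
        refine lintegral_congr fun x => ?_
        have hx : ‖(x : E)‖ ≠ 0 := norm_ne_zero_iff.2 x.2
        simp [smul_smul, hx]
    _ = ∫⁻ r : Ioi (0 : ℝ), ∫⁻ y : sphere (0 : E) 1, G (r.1 • y.1)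
          ∂((volume : Measure E).toSphere) ∂(Measure.volumeIoiPow (Module.finrank ℝ E - 1)) :=
        lintegral_prod_symm' _ (by fun_prop)
    _ = ∫⁻ r : Ioi (0 : ℝ), ∫⁻ y, G (r.1 • y) ∂(surfaceMeasure E)
          ∂(Measure.volumeIoiPow (Module.finrank ℝ E - 1)) := by
        refine lintegral_congr fun r => ?_
        rw [surfaceMeasure, lintegral_map (by fun_prop) measurable_subtype_coe]
    _ = _ := by
        have hm : Measurable fun r : ℝ => ∫⁻ y, G (r • y) ∂(surfaceMeasure E) :=
          hmeas.lintegral_prod_left'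
        refine (lintegral_withDensity_eq_lintegral_mul _ (by fun_prop)
          (hm.comp measurable_subtype_coe)).trans ?_
        exact lintegral_subtype_comap measurableSet_Ioi fun r : ℝ =>
          ENNReal.ofReal (r ^ (Module.finrank ℝ E - 1)) * ∫⁻ y, G (r • y) ∂(surfaceMeasure E)

theorem setLIntegral_ball_eq_lintegral_surfaceMeasure [Nontrivial E] {F : E → ℝ≥0∞}
    (hF : Measurable F) (x₀ : E) (d : ℝ) :
    ∫⁻ x in ball x₀ d, F x =
      ∫⁻ r in Ioo 0 d, ENNReal.ofReal (r ^ (Module.finrank ℝ E - 1)) *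
        ∫⁻ y, F (x₀ + r • y) ∂(surfaceMeasure E) := by
  rw [← lintegral_indicator measurableSet_ball,
    ← lintegral_add_left_eq_self ((ball x₀ d).indicator F) x₀,
    lintegral_eq_lintegral_Ioi_surfaceMeasure (G := fun x => (ball x₀ d).indicator F (x₀ + x))
      ((hF.indicator measurableSet_ball).comp (measurable_const_add x₀)),
    show Ioo 0 d = Iio d ∩ Ioi 0 from by ext; simp [and_comm],
    ← Measure.restrict_restrict measurableSet_Iio, ← lintegral_indicator measurableSet_Iio]
  refine setLIntegral_congr_fun measurableSet_Ioi fun r hr => ?_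
  have hball : ∀ᵐ y ∂(surfaceMeasure E), (x₀ + r • y ∈ ball x₀ d ↔ r < d) := by
    filter_upwards [ae_surfaceMeasure_mem_sphere] with y hy
    rw [mem_sphere_zero_iff_norm] at hy
    simp [norm_smul, hy, abs_of_pos (mem_Ioi.1 hr)]
  by_cases hrd : r < d
  · rw [indicator_of_mem (mem_Iio.2 hrd)]
    congr 1
    refine lintegral_congr_ae ?_
    filter_upwards [hball] with y hy
    rw [indicator_of_mem (hy.2 hrd)]
  · rw [indicator_of_notMem (by simpa using hrd)]
    refine mul_eq_zero_of_right _ ?_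
    refine (lintegral_congr_ae (g := fun _ => 0) ?_).trans lintegral_zero
    filter_upwards [hball] with y hy
    exact indicator_of_notMem (fun h => hrd (hy.1 h)) _

end Sphere

theorem setLIntegral_Ioo_eq_setLIntegral_exp {n d : ℝ} (hn : 0 < n) (hd : 0 < d)
    (g : ℝ → ℝ≥0∞) :
    ∫⁻ ρ in Ioo 0 d, g ρ =
      ∫⁻ s in Ioi 0, ENNReal.ofReal (d * Real.exp (-s / n) / n) * g (d * Real.exp (-s / n)) := by
  have himg : (fun s : ℝ => d * Real.exp (-s / n)) '' Ioi 0 = Ioo 0 d := by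
    ext ρ
    constructor
    · rintro ⟨s, hs, rfl⟩
      refine ⟨by positivity, ?_⟩
      have : Real.exp (-s / n) < 1 :=
        Real.exp_zero ▸ Real.exp_lt_exp.2 (div_neg_of_neg_of_pos (neg_lt_zero.2 (mem_Ioi.1 hs)) hn)
      simpa using mul_lt_mul_of_pos_left this hd
    · rintro ⟨h0, h1⟩
      refine ⟨-n * Real.log (ρ / d), ?_, ?_⟩
      · have : Real.log (ρ / d) < 0 := Real.log_neg (by positivity) ((div_lt_one hd).2 h1)
        rw [mem_Ioi]
        nlinarith
      · have : -(-n * Real.log (ρ / d)) / n = Real.log (ρ / d) := by field_simp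
        simp only [this]
        rw [Real.exp_log (by positivity)]
        field_simp
  have hinj : InjOn (fun s : ℝ => d * Real.exp (-s / n)) (Ioi 0) := by
    intro a _ b _ hab
    have := Real.exp_injective (mul_left_cancel₀ hd.ne' hab)
    field_simp at this
    linarith
  have hder : ∀ s ∈ Ioi (0 : ℝ), HasDerivWithinAt (fun s : ℝ => d * Real.exp (-s / n))
      (d * (Real.exp (-s / n) * (-1 / n))) (Ioi 0) s := fun s _ =>
    ((((hasDerivAt_id s).neg.div_const n).exp).const_mul d).hasDerivWithinAt
  rw [← himg, lintegral_image_eq_lintegral_abs_deriv_mul measurableSet_Ioi hder hinj]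
  refine lintegral_congr fun s => ?_
  congr 2
  rw [show d * (Real.exp (-s / n) * (-1 / n)) = -(d * Real.exp (-s / n) / n) by ring, abs_neg,
    abs_of_pos (by positivity)]

theorem setLIntegral_Ioi_eq_setLIntegral_exp {M : ℝ} (hM : 0 < M) (G : ℝ≥0∞ → ℝ≥0∞) :
    ∫⁻ τ in Ioi (Real.exp 1 * M), (ENNReal.ofReal τ * G (ENNReal.ofReal τ))⁻¹ =
      ∫⁻ s in Ioi 1, (G (ENNReal.ofReal (M * Real.exp s)))⁻¹ := by
  have himg : (fun s : ℝ => M * Real.exp s) '' Ioi 1 = Ioi (Real.exp 1 * M) := by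
    ext τ
    constructor
    · rintro ⟨s, hs, rfl⟩
      have : Real.exp 1 < Real.exp s := Real.exp_lt_exp.2 hs
      rw [mem_Ioi, mul_comm]
      exact mul_lt_mul_of_pos_left this hM
    · intro h
      rw [mem_Ioi, ← lt_div_iff₀ hM] at h
      have h0 : 0 < τ / M := (Real.exp_pos 1).trans h
      refine ⟨Real.log (τ / M), (Real.lt_log_iff_exp_lt h0).2 h, ?_⟩
      simp only [Real.exp_log h0]
      field_simp
  have hinj : InjOn (fun s : ℝ => M * Real.exp s) (Ioi 1) := fun a _ b _ hab =>
    Real.exp_injective (mul_left_cancel₀ hM.ne' hab)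
  have hder : ∀ s ∈ Ioi (1 : ℝ), HasDerivWithinAt (fun s : ℝ => M * Real.exp s)
      (M * Real.exp s) (Ioi 1) s := fun s _ =>
    ((Real.hasDerivAt_exp s).const_mul M).hasDerivWithinAt
  rw [← himg, lintegral_image_eq_lintegral_abs_deriv_mul measurableSet_Ioi hder hinj]
  refine lintegral_congr fun s => ?_
  have hpos : 0 < M * Real.exp s := by positivity
  have h0 : ENNReal.ofReal (M * Real.exp s) ≠ 0 := by simpa using hpos
  rw [abs_of_pos hpos, ENNReal.mul_inv (Or.inl h0) (Or.inl ENNReal.ofReal_ne_top), ← mul_assoc,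
    ENNReal.mul_inv_cancel h0 ENNReal.ofReal_ne_top, one_mul]

theorem setLIntegral_le_of_forall_Ioi_le {f : ℝ → ℝ≥0∞} {N B : ℝ≥0∞} {c : ℝ} (hc : 0 < c)
    (h : ∀ M : ℝ, 0 < M → N ≤ ENNReal.ofReal M → ∫⁻ τ in Ioi (c * M), f τ ≤ B) :
    ∫⁻ τ in {τ : ℝ | ENNReal.ofReal c * N < ENNReal.ofReal τ}, f τ ≤ B := by
  by_cases hN : N = ∞
  · have : {τ : ℝ | ENNReal.ofReal c * N < ENNReal.ofReal τ} = ∅ := by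
      ext τ
      simp [hN, ENNReal.mul_top, hc]
    rw [this]
    simp
  lift N to ℝ≥0 using hN
  have hunion : {τ : ℝ | ENNReal.ofReal c * N < ENNReal.ofReal τ} =
      ⋃ k : ℕ, Ioi (c * (N + 1 / ((k : ℝ) + 1))) := by
    ext τ
    have e : ENNReal.ofReal c * N = ENNReal.ofReal (c * N) := by
      rw [ENNReal.ofReal_mul hc.le, ENNReal.ofReal_coe_nnreal]
    simp only [mem_ofPred_eq, mem_iUnion, mem_Ioi]
    rw [e, ENNReal.ofReal_lt_ofReal_iff_of_nonneg (by positivity)]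
    constructor
    · intro hτ
      have : (0 : ℝ) < τ / c - N := by
        rw [sub_pos, lt_div_iff₀ hc]; linarith
      obtain ⟨k, hk⟩ := exists_nat_one_div_lt this
      refine ⟨k, ?_⟩
      have : N + 1 / ((k : ℝ) + 1) < τ / c := by linarith
      rw [lt_div_iff₀ hc] at this
      linarith
    · rintro ⟨k, hk⟩
      refine lt_trans ?_ hk
      have : (0 : ℝ) < 1 / ((k : ℝ) + 1) := by positivity
      gcongr
      linarith
  have hdir : Directed (· ⊆ ·) fun k : ℕ => Ioi (c * (N + 1 / ((k : ℝ) + 1))) := by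
    refine Monotone.directed_le fun k l hkl => Ioi_subset_Ioi ?_
    have : (k : ℝ) ≤ l := by exact_mod_cast hkl
    gcongr
  rw [hunion, setLIntegral_iUnion_of_directed _ hdir]
  refine iSup_le fun k => h _ (by positivity) ?_
  rw [← ENNReal.ofReal_coe_nnreal]
  refine ENNReal.ofReal_le_ofReal ?_
  have : (0 : ℝ) < 1 / ((k : ℝ) + 1) := by positivity
  linarith

theorem sphNorm_eq_zero {n : ℕ} (hn : 2 ≤ n) {Q : EuclideanSpace ℝ (Fin n) → ℝ≥0∞}
    (hQ : Measurable Q) (hW : μH[(n : ℝ) - 1] (sphere (0 : EuclideanSpace ℝ (Fin n)) 1) = 0)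
    (x₀ : EuclideanSpace ℝ (Fin n)) {ρ : ℝ} (hρ : 0 < ρ) : sphNorm n Q x₀ ρ = 0 := by
  have hn' : (1 : ℝ) < n := by exact_mod_cast hn
  rw [sphNorm, setLIntegral_sphere_hausdorffMeasure (by linarith) x₀ hρ (by fun_prop),
    setLIntegral_measure_zero _ _ hW, mul_zero, ENNReal.zero_rpow_of_pos]
  exact one_div_pos.2 (by linarith)

/-- The spherical norm through the mean value of `Q ^ (n - 1)` over the sphere. -/
theorem sphNorm_eq_mul_rpow {n : ℕ} (hn : 2 ≤ n) {Q : EuclideanSpace ℝ (Fin n) → ℝ≥0∞}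
    (hQ : Measurable Q) {W : ℝ≥0∞} (hW0 : W ≠ 0) (hWtop : W ≠ ∞)
    (x₀ : EuclideanSpace ℝ (Fin n)) {ρ : ℝ} (hρ : 0 < ρ) :
    sphNorm n Q x₀ ρ = ENNReal.ofReal ρ * W ^ (1 / ((n : ℝ) - 1)) *
      (∫⁻ y, Q (x₀ + ρ • y) ^ ((n : ℝ) - 1)
        ∂(W⁻¹ • μH[(n : ℝ) - 1].restrict (sphere (0 : EuclideanSpace ℝ (Fin n)) 1))) ^
          (1 / ((n : ℝ) - 1)) := by
  have hn' : (0 : ℝ) < (n : ℝ) - 1 := by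
    have : (1 : ℝ) < n := by exact_mod_cast hn
    linarith
  have hp : 0 ≤ 1 / ((n : ℝ) - 1) := (one_div_pos.2 hn').le
  rw [sphNorm, setLIntegral_sphere_hausdorffMeasure hn'.le x₀ hρ (by fun_prop),
    lintegral_smul_measure, smul_eq_mul, mul_assoc, ← ENNReal.mul_rpow_of_nonneg _ _ hp,
    ← mul_assoc W, ENNReal.mul_inv_cancel hW0 hWtop, one_mul, ENNReal.mul_rpow_of_nonneg _ _ hp,
    ← ENNReal.rpow_mul, mul_one_div_cancel hn'.ne', ENNReal.rpow_one]

theorem setLIntegral_le_const_mul_add_of_eq_const {α : Type*} [MeasurableSpace α] {μ : Measure α}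
    {D B : Set α} (hD : MeasurableSet D) (hB : MeasurableSet B) {F : α → ℝ≥0∞} {c : ℝ≥0∞}
    (hF : ∀ x ∉ D, F x = c) : ∫⁻ x in B, F x ∂μ ≤ c * μ B + ∫⁻ x in D, F x ∂μ := by
  rw [← lintegral_inter_add_sdiff F B hD, add_comm]
  refine add_le_add ?_ (lintegral_mono_set inter_subset_right)
  calc ∫⁻ x in B \ D, F x ∂μ = ∫⁻ _ in B \ D, c ∂μ :=
        setLIntegral_congr_fun (hB.diff hD) fun x hx => hF x hx.2
    _ = c * μ (B \ D) := setLIntegral_const _ _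
    _ ≤ c * μ B := by gcongr; exact sdiff_subset

/-- Let `n ≥ 2`, `D` a bounded domain in `ℝⁿ`, `Q : D → (0,∞)`
measurable, extended by `0` outside `D`, and `Φ : [0,∞] → [0,∞]` convex and
non-decreasing. For `x₀ ∈ ∂D`, `d₀ ∈ (0, sup_{z∈D}|z-x₀|)` and
`N = Φ(0) + (1/(Ω_n d₀ⁿ)) ∫_D Φ(Q^{n-1}(y)) dm(y)`, one has
`∫₀^{d₀} dρ/‖Q‖_{n-1}(x₀,ρ) ≥ (1/(n ω_{n-1}^{1/(n-1)})) ∫_{eN}^∞ dτ/(τ [Φ⁻¹(τ)]^{1/(n-1)})`. -/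
theorem stmt_10 (n : ℕ) (hn : 2 ≤ n)
    (D : Set (EuclideanSpace ℝ (Fin n))) (hD : IsOpen D) (hDconn : IsConnected D)
    (hDbdd : Bornology.IsBounded D)
    (Q : EuclideanSpace ℝ (Fin n) → ℝ≥0∞) (hQmeas : Measurable Q)
    (hQD : ∀ x ∈ D, 0 < Q x ∧ Q x < ∞) (hQ0 : ∀ x ∉ D, Q x = 0)
    (Φ : ℝ≥0∞ → ℝ≥0∞) (hΦmono : Monotone Φ)
    (hΦconv : ∀ (a : ℝ≥0), a ≤ 1 → ∀ t₁ t₂ : ℝ≥0∞,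
      Φ (a • t₁ + (1 - a) • t₂) ≤ a • Φ t₁ + (1 - a) • Φ t₂)
    (x₀ : EuclideanSpace ℝ (Fin n)) (hx₀ : x₀ ∈ frontier D)
    (d₀ : ℝ) (hd₀pos : 0 < d₀) (hd₀lt : ∃ z ∈ D, d₀ < dist z x₀)
    (N : ℝ≥0∞)
    (hN : N = Φ 0 +
      (volume (Metric.ball (0 : EuclideanSpace ℝ (Fin n)) 1) * ENNReal.ofReal (d₀ ^ n))⁻¹ *
        ∫⁻ y in D, Φ ((Q y) ^ ((n : ℝ) - 1))) :
    ((n : ℝ≥0∞) *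
        (μH[(n : ℝ) - 1] (Metric.sphere (0 : EuclideanSpace ℝ (Fin n)) 1)) ^ (1 / ((n : ℝ) - 1)))⁻¹ *
        ∫⁻ τ in {τ : ℝ | ENNReal.ofReal (Real.exp 1) * N < ENNReal.ofReal τ},
          (ENNReal.ofReal τ * (genInv Φ (ENNReal.ofReal τ)) ^ (1 / ((n : ℝ) - 1)))⁻¹
      ≤ ∫⁻ ρ in Set.Ioo (0 : ℝ) d₀, (sphNorm n Q x₀ ρ)⁻¹ := by
  have hn1 : (0 : ℝ) < (n : ℝ) - 1 := by
    have : (1 : ℝ) < n := by exact_mod_cast hn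
    linarith
  have hnpos : (0 : ℝ) < n := by linarith
  have hn0 : (n : ℝ≥0∞) ≠ 0 := by
    have : n ≠ 0 := by lia
    exact_mod_cast this
  have hp : 0 < 1 / ((n : ℝ) - 1) := one_div_pos.2 hn1
  have hWeq := hausdorffMeasure_smul_surfaceMeasure (E := EuclideanSpace ℝ (Fin n)) ((n : ℝ) - 1)
  have hsph0 := fun hW ρ (hρ : 0 < ρ) => sphNorm_eq_zero hn hQmeas hW x₀ hρ
  have hsph := fun (W : ℝ≥0∞) (hW0 : W ≠ 0) (hWtop : W ≠ ∞) (ρ : ℝ) (hρ : 0 < ρ) =>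
    sphNorm_eq_mul_rpow hn hQmeas hW0 hWtop x₀ hρ
  set W := μH[(n : ℝ) - 1] (sphere (0 : EuclideanSpace ℝ (Fin n)) 1)
  set p := 1 / ((n : ℝ) - 1)
  by_cases hWtop : W = ∞
  · rw [hWtop, ENNReal.top_rpow_of_pos hp, ENNReal.mul_top hn0, ENNReal.inv_top, zero_mul]
    exact zero_le
  by_cases hW0 : W = 0
  · have : ∫⁻ ρ in Ioo 0 d₀, (sphNorm n Q x₀ ρ)⁻¹ = ∫⁻ _ in Ioo 0 d₀, (∞ : ℝ≥0∞) :=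
      setLIntegral_congr_fun measurableSet_Ioo fun ρ hρ => by
        simp only [hsph0 hW0 ρ hρ.1, ENNReal.inv_zero]
    rw [this, setLIntegral_const, Real.volume_Ioo, ENNReal.top_mul (by simpa using hd₀pos)]
    exact le_top
  specialize hsph W hW0 hWtop
  specialize hWeq (lt_top_iff_ne_top.2 hWtop)
  set P := W⁻¹ • μH[(n : ℝ) - 1].restrict (sphere (0 : EuclideanSpace ℝ (Fin n)) 1) with hP
  have : IsProbabilityMeasure P := ⟨by
    rw [hP, Measure.smul_apply, Measure.restrict_apply_univ, smul_eq_mul]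
    exact ENNReal.inv_mul_cancel hW0 hWtop⟩
  have hσ : surfaceMeasure (EuclideanSpace ℝ (Fin n)) =
      (n * volume (ball (0 : EuclideanSpace ℝ (Fin n)) 1)) • P := by
    have h := congrArg (W⁻¹ • ·) hWeq
    simp only [smul_smul, ENNReal.inv_mul_cancel hW0 hWtop, one_smul] at h
    rw [h, surfaceMeasure_univ, finrank_euclideanSpace_fin, hP, smul_smul, mul_comm]
  set Ω := volume (ball (0 : EuclideanSpace ℝ (Fin n)) 1)
  have hΩ0 : Ω ≠ 0 := (measure_ball_pos _ _ one_pos).ne'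
  have hΩtop : Ω ≠ ∞ := measure_ball_lt_top.ne
  have hQfin : ∀ x, Q x ^ ((n : ℝ) - 1) < ∞ := fun x => by
    refine ENNReal.rpow_lt_top_of_nonneg hn1.le ?_
    by_cases hx : x ∈ D
    · exact (hQD x hx).2.ne
    · simp [hQ0 x hx]
  have hXmeas : Measurable fun x => Q x ^ ((n : ℝ) - 1) := by fun_prop
  have hFmeas : Measurable fun x => Φ (Q x ^ ((n : ℝ) - 1)) := hΦmono.measurable.comp hXmeas
  set h : ℝ → ℝ≥0∞ := fun ρ => ∫⁻ y, Φ (Q (x₀ + ρ • y) ^ ((n : ℝ) - 1)) ∂P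
  set q : ℝ → ℝ≥0∞ := fun ρ => ∫⁻ y, Q (x₀ + ρ • y) ^ ((n : ℝ) - 1) ∂P
  have hhmeas : Measurable h := by
    have : Measurable fun z : EuclideanSpace ℝ (Fin n) × ℝ =>
        Φ (Q (x₀ + z.2 • z.1) ^ ((n : ℝ) - 1)) := hFmeas.comp (by fun_prop)
    exact this.lintegral_prod_left'
  set r : ℝ → ℝ := fun s => d₀ * Real.exp (-s / n) with hr
  have hrpos : ∀ s, 0 < r s := fun s => by positivity
  have hd0 : ENNReal.ofReal (d₀ ^ n) ≠ 0 := by simpa using pow_pos hd₀pos n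
  have hc0 : Ω * ENNReal.ofReal (d₀ ^ n) ≠ 0 := mul_ne_zero hΩ0 hd0
  have hctop : Ω * ENNReal.ofReal (d₀ ^ n) ≠ ∞ := ENNReal.mul_ne_top hΩtop ENNReal.ofReal_ne_top
  have : Nontrivial (EuclideanSpace ℝ (Fin n)) :=
    Module.nontrivial_of_finrank_pos (R := ℝ) (by rw [finrank_euclideanSpace_fin]; lia)
  have hball : ∫⁻ x in ball x₀ d₀, Φ (Q x ^ ((n : ℝ) - 1)) =
      Ω * ENNReal.ofReal (d₀ ^ n) *
        ∫⁻ s in Ioi 0, ENNReal.ofReal (Real.exp (-s)) * h (r s) := by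
    rw [setLIntegral_ball_eq_lintegral_surfaceMeasure hFmeas, finrank_euclideanSpace_fin,
      setLIntegral_Ioo_eq_setLIntegral_exp hnpos hd₀pos,
      ← lintegral_const_mul _ (by fun_prop)]
    refine lintegral_congr fun s => ?_
    rw [hσ, lintegral_smul_measure, smul_eq_mul]
    change ENNReal.ofReal (r s / n) * (ENNReal.ofReal (r s ^ (n - 1)) * (n * Ω * h (r s))) = _
    have e : ENNReal.ofReal (r s / n) * ENNReal.ofReal (r s ^ (n - 1)) * n =
        ENNReal.ofReal (d₀ ^ n) * ENNReal.ofReal (Real.exp (-s)) := by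
      rw [← ENNReal.ofReal_natCast n, ← ENNReal.ofReal_mul (by positivity),
        ← ENNReal.ofReal_mul (by positivity), ← ENNReal.ofReal_mul (by positivity)]
      congr 1
      have h1 : r s ^ n = d₀ ^ n * Real.exp (-s) := by
        rw [hr, mul_pow, ← Real.exp_nat_mul]
        congr 2
        field_simp
      rw [← h1, ← Nat.sub_add_cancel (show 1 ≤ n by lia), pow_succ, Nat.sub_add_cancel (by lia)]
      field_simp
    calc _ = ENNReal.ofReal (r s / n) * ENNReal.ofReal (r s ^ (n - 1)) * n * Ω * h (r s) := by ring
      _ = _ := by rw [e]; ring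
  have hmean : ∫⁻ s in Ioi 0, ENNReal.ofReal (Real.exp (-s)) * h (r s) ≤ N := by
    have hle := setLIntegral_le_const_mul_add_of_eq_const (μ := volume) hD.measurableSet
      (measurableSet_ball (x := x₀) (ε := d₀)) (F := fun x => Φ (Q x ^ ((n : ℝ) - 1))) (c := Φ 0)
      (fun x hx => by simp only [hQ0 x hx, ENNReal.zero_rpow_of_pos hn1])
    rw [hball, Measure.addHaar_ball_of_pos _ _ hd₀pos, finrank_euclideanSpace_fin,
      mul_comm (ENNReal.ofReal _) (volume _)] at hle
    change _ ≤ Φ 0 * (Ω * ENNReal.ofReal (d₀ ^ n)) + _ at hle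
    rw [← ENNReal.mul_le_mul_iff_right hc0 hctop]
    refine hle.trans_eq ?_
    rw [hN, mul_add, ENNReal.mul_inv_cancel_left hc0 hctop, mul_comm (Φ 0)]
  have hright : ∫⁻ ρ in Ioo 0 d₀, (sphNorm n Q x₀ ρ)⁻¹ =
      (n * W ^ p)⁻¹ * ∫⁻ s in Ioi 0, (q (r s) ^ p)⁻¹ := by
    have hWp0 : W ^ p ≠ 0 := by simp [hW0, hWtop]
    have hWptop : W ^ p ≠ ∞ := ENNReal.rpow_ne_top_of_nonneg hp.le hWtop
    rw [setLIntegral_Ioo_eq_setLIntegral_exp hnpos hd₀pos,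
      ← lintegral_const_mul' _ _ (ENNReal.inv_ne_top.2 (mul_ne_zero hn0 hWp0))]
    refine lintegral_congr fun s => ?_
    change ENNReal.ofReal (r s / n) * (sphNorm n Q x₀ (r s))⁻¹ = _
    have hr0 : ENNReal.ofReal (r s) ≠ 0 := by simpa using hrpos s
    rw [hsph _ (hrpos s), ENNReal.mul_inv (Or.inl (mul_ne_zero hr0 hWp0))
      (Or.inl (ENNReal.mul_ne_top ENNReal.ofReal_ne_top hWptop)), ← mul_assoc]
    congr 1
    rw [ENNReal.mul_inv (Or.inl hr0) (Or.inl ENNReal.ofReal_ne_top),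
      ENNReal.mul_inv (Or.inl hn0) (Or.inl (ENNReal.natCast_ne_top n)),
      ENNReal.ofReal_div_of_pos hnpos, ENNReal.ofReal_natCast, ← mul_assoc]
    congr 1
    rw [ENNReal.div_eq_inv_mul, mul_assoc, ENNReal.mul_inv_cancel hr0 ENNReal.ofReal_ne_top,
      mul_one]
  rw [hright]
  refine mul_le_mul_right ?_ _
  refine setLIntegral_le_of_forall_Ioi_le (Real.exp_pos 1) fun M hM hNM => ?_
  rw [setLIntegral_Ioi_eq_setLIntegral_exp hM fun τ => genInv Φ τ ^ p]
  refine setLIntegral_inv_genInv_exp_le (h := fun s => h (r s)) (q := fun s => q (r s))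
    (by fun_prop) hM (hmean.trans hNM) (fun s τ hτ => ?_) hp.le
  exact ENNRealConvex.lintegral_le_genInv hΦmono hΦconv (hXmeas.comp (by fun_prop))
    (fun _ => hQfin _) hτ
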